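/- Let $R$ be a commutative ring, $k,j\ge 1$, $\eta\in R$, $M\in M_k(R)$, $F$ a $1\times k$ row vector over $R$, $G$ a $k\times 1$ column vector over $R$, and $p_1,\dots,p_j\in R$. Let $C\in M_j(R)$ be the matrix with $C_{i+1,i}=1$ for $1\le i\le j-1$, last-column entries $C_{i,j} = -p_{j-i+1}$ for $1\le i\le j$, and all other entries $0$. Let $\mathcal{A}\in M_{k+j}(R)$ be the block matrix with top-left block $M$, top-right block $G\,e_j^T$ (the $k\times j$ matrix whose only nonzero column is the last column, equal to $G$), bottom-left block $e_1 F$ (the $j\times k$ matrix whose only nonzero row is the first row, equal to $F$), and bottom-right block $C$. Then $\det\bigl(\eta I_{k+j} - \mathcal{A}\bigr) = \det(\eta I_k - M)\cdot\bigl(\eta^j + p_1\eta^{j-1} + \cdots + p_j\bigr) \; - \; F\,\mathrm{adj}(\eta I_k - M)\,G$. -/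

import Mathlib

open Matrix

lemma bordered_aux1 {R : Type*} [CommRing R] {m : Type*} [Fintype m] [DecidableEq m]
    (A : Matrix m m R) (F G : m → R) (q : R) (hA : IsRegular A.det) :
    (Matrix.fromBlocks A (Matrix.of fun i (_ : Fin 1) => -G i)
      (Matrix.of fun (_ : Fin 1) i => -F i) (Matrix.of fun _ _ => q)).det
      = A.det * q - F ⬝ᵥ A.adjugate.mulVec G := by
  apply hA.right
  have h : (Matrix.fromBlocks A (Matrix.of fun i (_ : Fin 1) => -G i)
      (Matrix.of fun (_ : Fin 1) i => -F i) (Matrix.of fun _ _ => q)) *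
      (Matrix.fromBlocks 1 (Matrix.of fun i (_ : Fin 1) => A.adjugate.mulVec G i)
      0 (Matrix.of fun _ _ => A.det)) =
      Matrix.fromBlocks A 0 (Matrix.of fun (_ : Fin 1) i => -F i)
        (Matrix.of fun _ _ => A.det * q - F ⬝ᵥ A.adjugate.mulVec G) := by
    rw [Matrix.fromBlocks_multiply]
    congr 1
    · simp
    · ext i x
      have : (A *ᵥ (A.adjugate *ᵥ G)) i = A.det * G i := by
        rw [Matrix.mulVec_mulVec, Matrix.mul_adjugate, Matrix.smul_mulVec]; simp
      simp only [Matrix.add_apply, Matrix.mul_apply, Matrix.of_apply, Matrix.zero_apply]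
      simp only [Matrix.mulVec, dotProduct] at this ⊢
      rw [this]; simp; ring
    · simp
    · ext i x
      simp [Matrix.mul_apply, dotProduct]; ring
  have h2 := congrArg Matrix.det h
  rw [Matrix.det_mul, Matrix.det_fromBlocks_zero₂₁, Matrix.det_fromBlocks_zero₁₂] at h2
  simp at h2
  simp only
  rw [h2]; ring

lemma bordered_aux2 {R : Type*} [CommRing R] {m : Type*} [Fintype m] [DecidableEq m]
    (A : Matrix m m R) (F G : m → R) (q : R) :
    (Matrix.fromBlocks A (Matrix.of fun i (_ : Fin 1) => -G i)
      (Matrix.of fun (_ : Fin 1) i => -F i) (Matrix.of fun _ _ => q)).det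
      = A.det * q - F ⬝ᵥ A.adjugate.mulVec G := by
  have h := bordered_aux1 (R := Polynomial R) (Matrix.charmatrix (-A))
    (fun i => Polynomial.C (F i)) (fun i => Polynomial.C (G i)) (Polynomial.C q)
    (Matrix.charpoly_monic (-A)).isRegular
  have h2 := congrArg (Polynomial.evalRingHom 0) h
  have hA : (Polynomial.evalRingHom (0:R)).mapMatrix (Matrix.charmatrix (-A)) = A := by
    ext i j
    by_cases hij : i = j
    · subst hij; simp [Matrix.charmatrix_apply]
    · simp [Matrix.charmatrix_apply, hij]
  rw [map_sub, map_mul, RingHom.map_det, RingHom.map_det, RingHom.map_dotProduct, hA] at h2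
  have hv : (Polynomial.evalRingHom (0:R)) ∘ ((Matrix.charmatrix (-A)).adjugate *ᵥ
      (fun i => Polynomial.C (G i))) = A.adjugate *ᵥ G := by
    ext i
    rw [Function.comp_apply, RingHom.map_mulVec]
    have : (Matrix.charmatrix (-A)).adjugate.map (Polynomial.evalRingHom (0:R)) = A.adjugate := by
      rw [← RingHom.mapMatrix_apply, RingHom.map_adjugate, hA]
    rw [this]
    congr 2
    ext i; simp
  rw [hv] at h2
  rw [RingHom.mapMatrix_apply, Matrix.fromBlocks_map, ← RingHom.mapMatrix_apply, hA] at h2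
  have e1 : (Matrix.of fun i (_ : Fin 1) => -Polynomial.C (G i)).map
      (Polynomial.evalRingHom (0:R)) = Matrix.of fun i (_ : Fin 1) => -G i := by
    ext; simp
  have e2 : (Matrix.of fun (_ : Fin 1) i => -Polynomial.C (F i)).map
      (Polynomial.evalRingHom (0:R)) = Matrix.of fun (_ : Fin 1) i => -F i := by
    ext; simp
  have e3 : (Matrix.of fun (_ _ : Fin 1) => Polynomial.C q).map
      (Polynomial.evalRingHom (0:R)) = Matrix.of fun (_ _ : Fin 1) => q := by
    ext; simp
  have e4 : (Polynomial.evalRingHom (0:R)) ∘ (fun i => Polynomial.C (F i)) = F := by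
    ext; simp
  have e5 : (Polynomial.evalRingHom (0:R)) (Polynomial.C q) = q := by simp
  rw [e1, e2, e3, e4, e5] at h2
  exact h2

/-- Determinant identity for the bordered companion block matrix:
`det(η·1 - 𝒜) = det(η·1 - M)(ηʲ + p₁ηʲ⁻¹ + ⋯ + p_j) - F · adj(η·1 - M) · G`,
where `𝒜` has blocks `M`, `G e_jᵀ`, `e₁ F`, `C` with `C` the companion-type matrix
with subdiagonal `1`s and last column `-p_{j-i+1}`. Here `p m` denotes `p_{m+1}`. -/
theorem bordered_companion_det {R : Type*} [CommRing R] (k j : ℕ)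
    (hk : 1 ≤ k) (hj : 1 ≤ j)
    (η : R) (M : Matrix (Fin k) (Fin k) R) (F G : Fin k → R) (p : Fin j → R) :
    Matrix.det
        (η • (1 : Matrix (Fin k ⊕ Fin j) (Fin k ⊕ Fin j) R)
          - Matrix.fromBlocks M
              (Matrix.of fun (i : Fin k) (jj : Fin j) => if (jj : ℕ) = j - 1 then G i else 0)
              (Matrix.of fun (ii : Fin j) (jj : Fin k) => if (ii : ℕ) = 0 then F jj else 0)
              (Matrix.of fun (ii jj : Fin j) =>
                if (jj : ℕ) = j - 1 then
                  -p ⟨j - 1 - (ii : ℕ), by omega⟩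
                else if (ii : ℕ) = (jj : ℕ) + 1 then 1 else 0))
      = Matrix.det (η • (1 : Matrix (Fin k) (Fin k) R) - M)
            * (η ^ j + ∑ m : Fin j, p m * η ^ (j - 1 - (m : ℕ)))
          - F ⬝ᵥ (Matrix.adjugate (η • (1 : Matrix (Fin k) (Fin k) R) - M)).mulVec G := by
  obtain ⟨n, rfl⟩ : ∃ n, j = n + 1 := ⟨j - 1, by omega⟩
  set A := η • (1 : Matrix (Fin k) (Fin k) R) - M with hAdef
  set q := η ^ (n+1) + ∑ m : Fin (n+1), p m * η ^ (n + 1 - 1 - (m : ℕ)) with hq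
  set N := (η • (1 : Matrix (Fin k ⊕ Fin (n+1)) (Fin k ⊕ Fin (n+1)) R) - _) with hN
  let U : Matrix (Fin (n+1)) (Fin (n+1)) R :=
    Matrix.of fun a b => if a = 0 then η ^ (b : ℕ) else if a = b then 1 else 0
  have hU : U.det = 1 := by
    rw [Matrix.det_of_isUpperTriangular]
    · apply Finset.prod_eq_one
      intro i _
      by_cases h : i = 0 <;> simp [U, h]
    · intro a b hab
      have hab : b < a := hab
      have h0 : a ≠ 0 := by rintro rfl; simp at hab
      simp [U, h0, hab.ne']
  let W := Matrix.fromBlocks 1 0 0 U * N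
  have hW : W.det = N.det := by
    simp only [W]
    rw [Matrix.det_mul, Matrix.det_fromBlocks_zero₂₁, hU]; simp
  let T : Matrix (Fin n) (Fin n) R :=
    Matrix.of fun a b => N (Sum.inr a.succ) (Sum.inr b.castSucc)
  have hT : T.det = (-1) ^ n := by
    rw [Matrix.det_of_isUpperTriangular]
    · rw [Finset.prod_eq_pow_card (b := (-1 : R))]
      · simp
      · intro i _
        have := i.2
        simp only [T, hN, Matrix.sub_apply, Matrix.smul_apply, Matrix.fromBlocks_apply₂₂,
          Matrix.of_apply, Matrix.one_apply, Sum.inr.injEq, Fin.ext_iff, Fin.val_castSucc,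
          Fin.val_succ, Nat.add_sub_cancel, this.ne, if_false, smul_eq_mul]
        simp
    · intro a b hab
      have hab : (b : ℕ) < a := hab
      have := b.2
      simp only [T, hN, Matrix.sub_apply, Matrix.smul_apply, Matrix.fromBlocks_apply₂₂,
          Matrix.of_apply, Matrix.one_apply, Sum.inr.injEq, Fin.ext_iff, Fin.val_castSucc,
          Fin.val_succ, Nat.add_sub_cancel, this.ne, if_false, smul_eq_mul]
      rw [if_neg (by omega), if_neg (by omega)]
      simp
  let c : (Fin k ⊕ Fin 1) ⊕ Fin n ≃ Fin k ⊕ Fin (n+1) :=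
    (Equiv.sumAssoc _ _ _).trans
      (Equiv.sumCongr (Equiv.refl _) ((Equiv.sumComm _ _).trans finSumFinEquiv))
  let s : Equiv.Perm (Fin k ⊕ Fin (n+1)) := Equiv.sumCongr (Equiv.refl _) (finRotate (n+1))
  have hs : Equiv.Perm.sign s = (-1) ^ n := by
    have := Equiv.Perm.sign_sumCongr (1 : Equiv.Perm (Fin k)) (finRotate (n+1))
    rw [sign_finRotate, map_one, one_mul] at this
    exact this
  have h1 : ((W.submatrix s id).submatrix c c).det = (-1) ^ n * N.det := by
    rw [Matrix.det_submatrix_equiv_self, Matrix.det_permute, hs, hW]; simp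
  have hWl : ∀ i x, W (Sum.inl i) x = N (Sum.inl i) x := by
    intro i x
    simp [W, Matrix.mul_apply, Matrix.one_apply]
  have hWs : ∀ (i : Fin n) x, W (Sum.inr i.succ) x = N (Sum.inr i.succ) x := by
    intro i x
    simp [W, Matrix.mul_apply, U]
  have hW0 : ∀ x, W (Sum.inr 0) x = ∑ b : Fin (n+1), η ^ (b : ℕ) * N (Sum.inr b) x := by
    intro i
    simp [W, Matrix.mul_apply, U]
  have hcl : ∀ i, c (Sum.inl (Sum.inl i)) = Sum.inl i := fun i => rfl
  have hcm : ∀ i, c (Sum.inl (Sum.inr i)) = Sum.inr (Fin.last n) := by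
    intro i; simp [c]; ext; simp
  have hcr : ∀ i, c (Sum.inr i) = Sum.inr i.castSucc := fun i => rfl
  have hsl : ∀ i, s (Sum.inl i) = Sum.inl i := fun i => rfl
  have hsm : s (Sum.inr (Fin.last n)) = Sum.inr 0 := by simp [s]
  have hsr : ∀ i : Fin n, s (Sum.inr i.castSucc) = Sum.inr i.succ := by
    intro i; simp [s]
  have h2 : (W.submatrix s id).submatrix c c = Matrix.fromBlocks
      (Matrix.fromBlocks A (Matrix.of fun i (_ : Fin 1) => -G i)
      (Matrix.of fun (_ : Fin 1) i => -F i) (Matrix.of fun _ _ => q)) 0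
      (Matrix.of fun a x => N (Sum.inr a.succ) (c (Sum.inl x))) T := by
    ext a b
    rcases a with (a | a) | a <;> rcases b with (b | b) | b <;>
      simp only [Matrix.submatrix_apply, id, hcl, hcm, hcr, hsl, hsm, hsr, hWl, hWs, hW0,
        Matrix.fromBlocks_apply₁₁, Matrix.fromBlocks_apply₁₂, Matrix.fromBlocks_apply₂₁,
        Matrix.fromBlocks_apply₂₂, Matrix.of_apply, Matrix.zero_apply, T]
    · simp [hN, hAdef, Matrix.one_apply]
    · simp [hN]
    · have := b.2
      simp [hN, this.ne]
    · simp [hN]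
    · have e : ∀ x : Fin (n+1), η ^ (x:ℕ) * N (Sum.inr x) (Sum.inr (Fin.last n)) =
          (if x = Fin.last n then η ^ (n+1) else 0) +
          p (Fin.rev x) * η ^ (n + 1 - 1 - (Fin.rev x : ℕ)) := by
        intro x
        have hx : n + 1 - 1 - (Fin.rev x : ℕ) = x := by
          have := x.2
          simp [Fin.val_rev]; omega
        have hx2 : (⟨n + 1 - 1 - (x:ℕ), by omega⟩ : Fin (n+1)) = Fin.rev x := by
          ext; simp [Fin.val_rev]
        rw [hx]
        simp only [hN, Matrix.sub_apply, Matrix.smul_apply, Matrix.fromBlocks_apply₂₂,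
          Matrix.of_apply, Fin.val_last, hx2, Matrix.one_apply, Sum.inr.injEq]
        by_cases h : x = Fin.last n
        · subst h; simp; ring
        · simp [h]; ring
      rw [Finset.sum_congr rfl (fun x _ => e x), Finset.sum_add_distrib, hq]
      congr 1
      · simp
      · exact Equiv.sum_comp Fin.revPerm
          (fun x : Fin (n+1) => p x * η ^ (n + 1 - 1 - (x : ℕ)))
    · have hb := b.2
      have e : ∀ x : Fin (n+1), η ^ (x:ℕ) * N (Sum.inr x) (Sum.inr b.castSucc) =
          (if x = b.castSucc then η ^ ((b:ℕ)+1) else 0) -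
          (if x = b.succ then η ^ ((b:ℕ)+1) else 0) := by
        intro x
        simp only [hN, Matrix.sub_apply, Matrix.smul_apply, Matrix.fromBlocks_apply₂₂,
          Matrix.of_apply, Matrix.one_apply, Sum.inr.injEq, Fin.ext_iff, Fin.val_castSucc,
          Fin.val_succ, Nat.add_sub_cancel, hb.ne, if_false, smul_eq_mul]
        by_cases h : (x:ℕ) = b
        · simp [h]; ring
        · by_cases h' : (x:ℕ) = b + 1
          · simp [h']
          · simp [h, h']
      rw [Finset.sum_congr rfl (fun x _ => e x), Finset.sum_sub_distrib]
      simp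
  rw [h2, Matrix.det_fromBlocks_zero₁₂, bordered_aux2, hT] at h1
  have h3 : ((-1 : R) ^ n) * (-1) ^ n = 1 := by
    rw [← mul_pow]; simp
  calc N.det = ((-1) ^ n * (-1) ^ n) * N.det := by rw [h3, one_mul]
    _ = (-1) ^ n * ((A.det * q - F ⬝ᵥ A.adjugate *ᵥ G) * (-1) ^ n) := by rw [h1]; ring
    _ = ((-1) ^ n * (-1) ^ n) * (A.det * q - F ⬝ᵥ A.adjugate *ᵥ G) := by ring
    _ = _ := by rw [h3, one_mul]
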